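/- arXiv:2308.02832 — 10 statements merged into one kernel-verified Lean document; each statement's English description precedes it below -/
import Mathlib

section
/- Let t₀ ∈ ℝ, let f, h : [t₀, ∞) → ℝ be positive continuous functions, and let E : [t₀, ∞) → ℝ be a positive continuously differentiable function satisfying E'(t) ≤ f(t)·√(E(t)) + h(t) for all t ≥ t₀. Then for every t ≥ t₀ one has √(E(t)) ≤ √(E(t₀)) + √(∫_{t₀}^t h(s) ds) + (1/2)·∫_{t₀}^t f(s) ds. -/
/-- The primitive of a function continuous on `[a, ∞)` has the expected derivative
within `[a, ∞)`. -/
theorem hasDerivWithinAt_integral_of_continuousOn_Ici {g : ℝ → ℝ} {a x : ℝ}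
    (hg : ContinuousOn g (Set.Ici a)) (hx : a ≤ x) :
    HasDerivWithinAt (fun t => ∫ s in a..t, g s) (g x) (Set.Ici a) x := by
  have hcont : Continuous fun s => g (max a s) :=
    hg.comp_continuous (by fun_prop) fun s => le_max_left a s
  have hderiv := (hcont.integral_hasStrictDerivAt a x).hasDerivAt.hasDerivWithinAt
    (s := Set.Ici a)
  rw [max_eq_right hx] at hderiv
  have heq : ∀ t ∈ Set.Ici a, ∫ s in a..t, g s = ∫ s in a..t, g (max a s) := by
    intro t ht
    refine intervalIntegral.integral_congr fun s hs => ?_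
    rw [Set.uIcc_of_le ht] at hs
    simp only [max_eq_right hs.1]
  exact hderiv.congr heq (heq x hx)

/-- Gronwall-type lemma (Lemma 7.2 of the paper): if `E` is a positive `C¹`
function on `[t₀, ∞)` with `E' ≤ f·√E + h` for positive continuous `f, h`, then
`√(E t) ≤ √(E t₀) + √(∫_{t₀}^t h) + (1/2)∫_{t₀}^t f`. -/
theorem stmt0 (t₀ : ℝ) (f h E E' : ℝ → ℝ)
    (hf_cont : ContinuousOn f (Set.Ici t₀))
    (hh_cont : ContinuousOn h (Set.Ici t₀))
    (hf_pos : ∀ t, t₀ ≤ t → 0 < f t)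
    (hh_pos : ∀ t, t₀ ≤ t → 0 < h t)
    (hE_pos : ∀ t, t₀ ≤ t → 0 < E t)
    (hE'_cont : ContinuousOn E' (Set.Ici t₀))
    (hE_deriv : ∀ t, t₀ ≤ t → HasDerivWithinAt E (E' t) (Set.Ici t₀) t)
    (hineq : ∀ t, t₀ ≤ t → E' t ≤ f t * Real.sqrt (E t) + h t) :
    ∀ t, t₀ ≤ t →
      Real.sqrt (E t) ≤ Real.sqrt (E t₀) + Real.sqrt (∫ s in t₀..t, h s)
        + (1 / 2) * ∫ s in t₀..t, f s := by
  intro T hT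
  set H : ℝ → ℝ := fun t => ∫ s in t₀..t, h s with hH
  set F : ℝ → ℝ := fun t => ∫ s in t₀..t, f s with hF
  have hH_nonneg : ∀ t, t₀ ≤ t → 0 ≤ H t := fun t ht =>
    intervalIntegral.integral_nonneg ht fun s hs => (hh_pos s hs.1).le
  have hF_nonneg : ∀ t, t₀ ≤ t → 0 ≤ F t := fun t ht =>
    intervalIntegral.integral_nonneg ht fun s hs => (hf_pos s hs.1).le
  have hE₀ : 0 < E t₀ := hE_pos t₀ le_rfl
  have hEH_pos : ∀ t, t₀ ≤ t → 0 < E t₀ + H t := fun t ht =>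
    add_pos_of_pos_of_nonneg hE₀ (hH_nonneg t ht)
  have hu : ∀ t, t₀ ≤ t → HasDerivWithinAt (fun t => √(E t))
      (E' t / (2 * √(E t))) (Set.Ici t₀) t := fun t ht =>
    (hE_deriv t ht).sqrt (hE_pos t ht).ne'
  have hB : ∀ ε t, t₀ ≤ t → HasDerivWithinAt (fun t => √(E t₀ + H t) + 1 / 2 * F t + ε)
      (h t / (2 * √(E t₀ + H t)) + 1 / 2 * f t) (Set.Ici t₀) t := fun ε t ht =>
    (((((hasDerivWithinAt_integral_of_continuousOn_Ici hh_cont ht).const_add (E t₀)).sqrt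
      (hEH_pos t ht).ne').add
      ((hasDerivWithinAt_integral_of_continuousOn_Ici hf_cont ht).const_mul (1 / 2))).add_const ε)
  -- `√(E t₀ + H) + F / 2 + ε` is a strict supersolution of the equation for `√E`.
  have hcompare : √(E T) ≤ √(E t₀ + H T) + 1 / 2 * F T := by
    refine le_of_forall_pos_le_add fun ε hε => ?_
    refine image_le_of_deriv_right_lt_deriv_boundary'
      (f := fun t => √(E t)) (B := fun t => √(E t₀ + H t) + 1 / 2 * F t + ε)
      (fun t ht => (hu t ht.1).continuousWithinAt.mono Set.Icc_subset_Ici_self)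
      (fun t ht => (hu t ht.1).mono (Set.Ici_subset_Ici.2 ht.1)) ?_
      (fun t ht => (hB ε t ht.1).continuousWithinAt.mono Set.Icc_subset_Ici_self)
      (fun t ht => (hB ε t ht.1).mono (Set.Ici_subset_Ici.2 ht.1)) ?_ ⟨hT, le_rfl⟩
    · simp [hH, hF, hε.le]
    · intro t ht heq
      have hlt : √(E t₀ + H t) < √(E t) := by
        have := hF_nonneg t ht.1
        linarith
      have hpos : 0 < √(E t₀ + H t) := Real.sqrt_pos.2 (hEH_pos t ht.1)
      have hEpos : 0 < √(E t) := hpos.trans hlt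
      calc E' t / (2 * √(E t)) ≤ (f t * √(E t) + h t) / (2 * √(E t)) := by
            gcongr
            exact hineq t ht.1
        _ = h t / (2 * √(E t)) + 1 / 2 * f t := by
            field_simp
            ring
        _ < h t / (2 * √(E t₀ + H t)) + 1 / 2 * f t := by
            have := hh_pos t ht.1
            gcongr
  have hsub : √(E t₀ + H T) ≤ √(E t₀) + √(H T) := by
    refine Real.sqrt_le_iff.2 ⟨by positivity, ?_⟩
    rw [add_sq, Real.sq_sqrt hE₀.le, Real.sq_sqrt (hH_nonneg T hT)]
    have : 0 ≤ 2 * √(E t₀) * √(H T) := by positivity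
    linarith
  linarith
end

section
/- Let k : [0, ∞) → ℝ be continuous and let G : [0, ∞) → ℝ be twice continuously differentiable with G(0) = 0, G'(0) = 1, and G''(ρ) = k(ρ)²·G(ρ) for all ρ ≥ 0. Then for every ρ ≥ 0 one has G'(ρ) ≤ exp(∫₀^ρ s·k(s)² ds) and G(ρ) ≤ ρ·exp(∫₀^ρ s·k(s)² ds). -/
open Set in
/-- A function on `[0, ∞)` with nonnegative derivative is monotone. -/
theorem monotoneOn_Ici_of_hasDerivWithinAt_nonneg {f f' : ℝ → ℝ}
    (hf : ∀ x ∈ Ici (0 : ℝ), HasDerivWithinAt f (f' x) (Ici 0) x)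
    (hf' : ∀ x ∈ Ici (0 : ℝ), 0 ≤ f' x) : MonotoneOn f (Ici 0) :=
  monotoneOn_of_hasDerivWithinAt_nonneg (convex_Ici 0) (fun x hx => (hf x hx).continuousWithinAt)
    (fun x hx => (hf x (interior_subset hx)).mono interior_subset)
    (fun x hx => hf' x (interior_subset hx))

open Set Filter Topology in
/-- A solution of the Jacobi equation `G'' = k² G` with `G 0 = 0` and `G' 0 = 1` is nonnegative:
`G²` is nondecreasing, so `G` cannot return to zero after being positive. -/
theorem jacobi_nonneg {k G G' : ℝ → ℝ}
    (hd1 : ∀ ρ ∈ Ici (0 : ℝ), HasDerivWithinAt G (G' ρ) (Ici 0) ρ)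
    (hd2 : ∀ ρ ∈ Ici (0 : ℝ), HasDerivWithinAt G' (k ρ ^ 2 * G ρ) (Ici 0) ρ)
    (hG0 : G 0 = 0) (hG'0 : G' 0 = 1) {ρ : ℝ} (hρ : 0 ≤ ρ) : 0 ≤ G ρ := by
  have hGG' : ∀ x ∈ Ici (0 : ℝ), 0 ≤ G x * G' x := by
    intro x hx
    have hmono := monotoneOn_Ici_of_hasDerivWithinAt_nonneg
      (fun y hy => (hd1 y hy).mul (hd2 y hy))
      (fun y _ => by nlinarith [sq_nonneg (G' y), sq_nonneg (k y * G y)])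
    simpa [hG0] using hmono self_mem_Ici hx hx
  have hsq : MonotoneOn (fun x => G x * G x) (Ici 0) :=
    monotoneOn_Ici_of_hasDerivWithinAt_nonneg (fun y hy => (hd1 y hy).mul (hd1 y hy))
      (fun y hy => by nlinarith [hGG' y hy])
  by_contra! hneg
  have hρ0 : 0 < ρ := hρ.lt_of_ne (by rintro rfl; linarith)
  have hslope : Tendsto (slope G 0) (𝓝[>] 0) (𝓝 1) := by
    have h := hasDerivWithinAt_iff_tendsto_slope.1 (hd1 0 self_mem_Ici)
    rwa [Ici_sdiff_left, hG'0] at h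
  obtain ⟨δ, hδpos, hδ⟩ := ((hslope.eventually (lt_mem_nhds one_pos)).and
    (Ioo_mem_nhdsGT hρ0)).exists
  have hGδ : 0 < G δ := by
    rw [slope_def_field, hG0, sub_zero, sub_zero] at hδpos
    exact (div_pos_iff_of_pos_right hδ.1).1 hδpos
  have hcont : ContinuousOn G (Icc δ ρ) := fun x hx =>
    (hd1 x (hδ.1.le.trans hx.1)).continuousWithinAt.mono fun y hy => hδ.1.le.trans hy.1
  obtain ⟨c, hc, hGc⟩ := intermediate_value_Icc' hδ.2.le hcont ⟨hneg.le, hGδ.le⟩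
  have hle := hsq (mem_Ici.2 hδ.1.le) (mem_Ici.2 (hδ.1.le.trans hc.1)) hc.1
  simp only [hGc, mul_zero] at hle
  nlinarith

/-- For the Jacobi (Gauss) equation `G'' = k²·G` with `G(0) = 0`, `G'(0) = 1`,
one has `G'(ρ) ≤ exp(∫₀^ρ s·k(s)² ds)` and `G(ρ) ≤ ρ·exp(∫₀^ρ s·k(s)² ds)`. -/
theorem stmt3 (k G G' G'' : ℝ → ℝ)
    (hk_cont : ContinuousOn k (Set.Ici 0))
    (hG''_cont : ContinuousOn G'' (Set.Ici 0))
    (hd1 : ∀ ρ ∈ Set.Ici (0:ℝ), HasDerivWithinAt G (G' ρ) (Set.Ici 0) ρ)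
    (hd2 : ∀ ρ ∈ Set.Ici (0:ℝ), HasDerivWithinAt G' (G'' ρ) (Set.Ici 0) ρ)
    (hG0 : G 0 = 0) (hG'0 : G' 0 = 1)
    (heq : ∀ ρ ∈ Set.Ici (0:ℝ), G'' ρ = k ρ ^ 2 * G ρ) :
    ∀ ρ ∈ Set.Ici (0:ℝ),
      G' ρ ≤ Real.exp (∫ s in (0:ℝ)..ρ, s * k s ^ 2) ∧
      G ρ ≤ ρ * Real.exp (∫ s in (0:ℝ)..ρ, s * k s ^ 2) := by
  have hd2' : ∀ ρ ∈ Set.Ici (0 : ℝ), HasDerivWithinAt G' (k ρ ^ 2 * G ρ) (Set.Ici 0) ρ :=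
    fun ρ hρ => heq ρ hρ ▸ hd2 ρ hρ
  have hG : ∀ ρ ∈ Set.Ici (0 : ℝ), 0 ≤ G ρ := fun ρ hρ => jacobi_nonneg hd1 hd2' hG0 hG'0 hρ
  have hGle : ∀ ρ ∈ Set.Ici (0 : ℝ), G ρ ≤ ρ * G' ρ := by
    intro ρ hρ
    have hmono := monotoneOn_Ici_of_hasDerivWithinAt_nonneg
      (fun y hy => ((hasDerivWithinAt_id y _).mul (hd2' y hy)).sub (hd1 y hy))
      (fun y hy => by
        have := mul_nonneg (Set.mem_Ici.1 hy) (mul_nonneg (sq_nonneg (k y)) (hG y hy))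
        simpa using this)
    simpa [hG0] using hmono Set.self_mem_Ici hρ hρ
  -- Extend the integrand continuously to all of `ℝ`.
  let p : ℝ → ℝ := fun s => s * k (max s 0) ^ 2
  have hp : Continuous p := by
    have hkmax : Continuous fun s : ℝ => k (max s 0) :=
      hk_cont.comp_continuous (by fun_prop) fun s => le_max_right s 0
    exact continuous_id.mul (hkmax.pow 2)
  have hint : ∀ ρ ∈ Set.Ici (0 : ℝ), ∫ s in (0:ℝ)..ρ, s * k s ^ 2 = ∫ s in (0:ℝ)..ρ, p s := by
    intro ρ hρ
    refine intervalIntegral.integral_congr fun s hs => ?_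
    rw [Set.uIcc_of_le hρ] at hs
    simp [p, max_eq_left hs.1]
  have hI : ∀ ρ, HasDerivAt (fun x => ∫ s in (0:ℝ)..x, p s) (p ρ) ρ := fun ρ =>
    hp.integral_hasStrictDerivAt 0 ρ |>.hasDerivAt
  intro ρ hρ
  have hG'le : G' ρ ≤ Real.exp (∫ s in (0:ℝ)..ρ, s * k s ^ 2) := by
    have hmono := monotoneOn_Ici_of_hasDerivWithinAt_nonneg
      (fun y hy => ((hd2' y hy).mul (hI y).neg.exp.hasDerivWithinAt).neg)
      (fun y hy => by
        have hpy : p y = y * k y ^ 2 := by simp [p, max_eq_left (Set.mem_Ici.1 hy)]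
        have := mul_nonneg (mul_nonneg (sq_nonneg (k y)) (sub_nonneg.2 (hGle y hy)))
          (Real.exp_pos (-∫ s in (0:ℝ)..y, p s)).le
        simp only [hpy, Pi.neg_apply]
        linarith)
    have h := hmono Set.self_mem_Ici hρ hρ
    simp only [Pi.neg_apply, Pi.mul_apply, intervalIntegral.integral_same, Real.exp_zero,
      hG'0, inv_one, mul_one, neg_le_neg_iff, Real.exp_neg] at h
    rw [hint ρ hρ]
    rwa [← div_eq_mul_inv, div_le_one (Real.exp_pos _)] at h
  exact ⟨hG'le, (hGle ρ hρ).trans (mul_le_mul_of_nonneg_left hG'le hρ)⟩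
end

section
/- Let δ ∈ (0, 1/2), λ₀ > 0, and let k* : (0, ∞) → (0, ∞) be continuous such that the function ρ ↦ ρ^{1+δ}·k*(ρ) is monotone (either nondecreasing or nonincreasing) on [λ₀, ∞), and such that ∫₀^∞ ρ·k*(ρ)² dρ < ∞. Then ρ·k*(ρ) → 0 as ρ → ∞. -/
open Filter MeasureTheory Set

/-- Dyadic blocks of a convergent integral over `(0, ∞)` tend to zero. -/
theorem tendsto_integral_dyadic_atTop {f : ℝ → ℝ} (hf : IntegrableOn f (Ioi 0)) :
    Tendsto (fun a : ℝ => ∫ t in a..(2 * a), f t) atTop (nhds 0) := by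
  have hlim := intervalIntegral_tendsto_integral_Ioi 0 hf tendsto_id
  have hdouble : Tendsto (fun a : ℝ => 2 * a) atTop atTop :=
    tendsto_id.const_mul_atTop two_pos
  have hdiff := (hlim.comp hdouble).sub hlim
  rw [sub_self] at hdiff
  refine hdiff.congr' ?_
  filter_upwards [eventually_gt_atTop 0] with a ha
  have hint : ∀ b : ℝ, 0 ≤ b → IntervalIntegrable f volume 0 b := fun b hb =>
    (intervalIntegrable_iff_integrableOn_Ioc_of_le hb).2 (hf.mono_set Ioc_subset_Ioi_self)
  exact intervalIntegral.integral_interval_sub_left (hint (2 * a) (by positivity)) (hint a ha.le)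

/-- A lower bound `c ≤ t * k t` on `[a, 2a]` bounds `c ^ 2` by the integral of `t * k t ^ 2`. -/
theorem sq_le_two_mul_integral_dyadic {k : ℝ → ℝ} {a c : ℝ} (ha : 0 < a) (hc : 0 ≤ c)
    (hint : IntegrableOn (fun t => t * k t ^ 2) (Ioi 0))
    (hle : ∀ t ∈ Icc a (2 * a), c ≤ t * k t) :
    c ^ 2 ≤ 2 * ∫ t in a..(2 * a), t * k t ^ 2 := by
  have hab : a ≤ 2 * a := by linarith
  have hii : IntervalIntegrable (fun t => t * k t ^ 2) volume a (2 * a) :=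
    (intervalIntegrable_iff_integrableOn_Ioc_of_le hab).2
      (hint.mono_set fun t ht => ha.trans ht.1)
  have hbound : ∫ _ in a..(2 * a), c ^ 2 / (2 * a) ≤ ∫ t in a..(2 * a), t * k t ^ 2 := by
    refine intervalIntegral.integral_mono_on hab intervalIntegrable_const hii fun t ht => ?_
    have ht0 : 0 < t := ha.trans_le ht.1
    calc c ^ 2 / (2 * a) ≤ (t * k t) ^ 2 / t := by
          gcongr
          exacts [hle t ht, ht.2]
      _ = t * k t ^ 2 := by field_simp
  rw [intervalIntegral.integral_const, smul_eq_mul] at hbound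
  have hval : (2 * a - a) * (c ^ 2 / (2 * a)) = c ^ 2 / 2 := by
    field_simp
    ring
  linarith

/-- If `ρ^{1+δ}·k*(ρ)` is monotone on `[lam₀, ∞)` for some `δ ∈ (0, 1/2)` and
`∫₀^∞ ρ·k*(ρ)² dρ < ∞`, then `ρ·k*(ρ) → 0` as `ρ → ∞`. -/
theorem stmt6 (δ lam₀ : ℝ) (hδ : δ ∈ Set.Ioo (0:ℝ) (1/2)) (hlam₀ : 0 < lam₀)
    (kstar : ℝ → ℝ)
    (hk_cont : ContinuousOn kstar (Set.Ioi 0))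
    (hk_pos : ∀ ρ > (0:ℝ), 0 < kstar ρ)
    (hmono : MonotoneOn (fun ρ => ρ ^ (1 + δ) * kstar ρ) (Set.Ici lam₀)
      ∨ AntitoneOn (fun ρ => ρ ^ (1 + δ) * kstar ρ) (Set.Ici lam₀))
    (hint : MeasureTheory.IntegrableOn (fun ρ => ρ * kstar ρ ^ 2) (Set.Ioi 0)) :
    Filter.Tendsto (fun ρ => ρ * kstar ρ) Filter.atTop (nhds 0) := by
  have hrpow : ∀ t : ℝ, 0 < t → t ^ (1 + δ) * kstar t = t * kstar t * t ^ δ := fun t ht => by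
    rw [Real.rpow_add ht, Real.rpow_one]
    ring
  have hpos : ∀ t : ℝ, 0 < t → 0 < t * kstar t := fun t ht => mul_pos ht (hk_pos t ht)
  have hdyadic := tendsto_integral_dyadic_atTop hint
  suffices hsq : Tendsto (fun ρ => (ρ * kstar ρ) ^ 2) atTop (nhds 0) by
    have hsqrt := hsq.sqrt
    rw [Real.sqrt_zero] at hsqrt
    refine hsqrt.congr' ?_
    filter_upwards [eventually_gt_atTop 0] with ρ hρ
    exact Real.sqrt_sq (hpos ρ hρ).le
  rcases hmono with hmono | hanti
  · refine squeeze_zero' (Eventually.of_forall fun ρ => sq_nonneg _) ?_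
      (by simpa using hdyadic.const_mul 8)
    filter_upwards [eventually_ge_atTop lam₀] with ρ hρ
    have hρ0 : 0 < ρ := hlam₀.trans_le hρ
    have hblock := sq_le_two_mul_integral_dyadic (c := ρ * kstar ρ / 2) hρ0
      (half_pos (hpos ρ hρ0)).le hint fun t ht => by
        have ht0 : 0 < t := hρ0.trans_le ht.1
        have hcomp : ρ ^ (1 + δ) * kstar ρ ≤ t ^ (1 + δ) * kstar t :=
          hmono hρ (hρ.trans ht.1) ht.1
        rw [hrpow ρ hρ0, hrpow t ht0] at hcomp
        have htwo : (2 : ℝ) ^ δ ≤ 2 :=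
          Real.rpow_le_self_of_one_le one_le_two (by linarith [hδ.2])
        have hpow : t ^ δ ≤ 2 * ρ ^ δ :=
          calc t ^ δ ≤ (2 * ρ) ^ δ := Real.rpow_le_rpow ht0.le ht.2 hδ.1.le
            _ = 2 ^ δ * ρ ^ δ := Real.mul_rpow two_pos.le hρ0.le
            _ ≤ 2 * ρ ^ δ := by gcongr
        have hscaled := mul_le_mul_of_nonneg_left hpow (hpos t ht0).le
        have hcancel : ρ * kstar ρ ≤ 2 * (t * kstar t) :=
          le_of_mul_le_mul_right (by linarith) (Real.rpow_pos_of_pos hρ0 δ)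
        linarith
    linarith
  · have hhalf : Tendsto (fun ρ : ℝ => ρ / 2) atTop atTop :=
      tendsto_id.atTop_div_const two_pos
    refine squeeze_zero' (Eventually.of_forall fun ρ => sq_nonneg _) ?_
      (by simpa using (hdyadic.comp hhalf).const_mul 2)
    filter_upwards [hhalf.eventually_ge_atTop lam₀] with ρ hρ
    have ha : 0 < ρ / 2 := hlam₀.trans_le hρ
    have hρ0 : 0 < ρ := by linarith
    refine sq_le_two_mul_integral_dyadic ha (hpos ρ hρ0).le hint fun t ht => ?_
    have ht0 : 0 < t := ha.trans_le ht.1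
    have htρ : t ≤ ρ := by linarith [ht.2]
    have ht1 : lam₀ ≤ t := hρ.trans ht.1
    have hcomp : ρ ^ (1 + δ) * kstar ρ ≤ t ^ (1 + δ) * kstar t :=
      hanti ht1 (ht1.trans htρ) htρ
    rw [hrpow ρ hρ0, hrpow t ht0] at hcomp
    have hscaled := mul_le_mul_of_nonneg_left
      (Real.rpow_le_rpow ht0.le htρ hδ.1.le) (hpos t ht0).le
    exact le_of_mul_le_mul_right (hcomp.trans hscaled) (Real.rpow_pos_of_pos hρ0 δ)
end

section
/- Let κ : [0, ∞) → ℝ be continuous and let B : [0, ∞) → ℝ be twice continuously differentiable with B(0) = 1, B'(0) = 0, and B''(t) = κ(t)²·B(t) for all t ≥ 0. Then B(t) ≥ 1 for all t ≥ 0, and for every t ≥ 0 one has ∫₀^t κ(s)² ds ≤ B'(t) ≤ (∫₀^t κ(s)² ds)·exp(∫₀^t s·κ(s)² ds). -/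
open Set

/-- A function with nonnegative derivative on `[0, ∞)` is bounded below there by its value at `0`. -/
lemma le_of_hasDerivWithinAt_Ici_nonneg {f f' : ℝ → ℝ}
    (hf : ∀ t ∈ Ici (0 : ℝ), HasDerivWithinAt f (f' t) (Ici 0) t)
    (hf' : ∀ t ∈ Ici (0 : ℝ), 0 ≤ f' t) {t : ℝ} (ht : t ∈ Ici (0 : ℝ)) : f 0 ≤ f t :=
  monotoneOn_of_hasDerivWithinAt_nonneg (convex_Ici 0)
    (fun x hx => (hf x hx).continuousWithinAt)
    (fun x hx => (hf x (interior_subset hx)).mono interior_subset)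
    (fun x hx => hf' x (interior_subset hx)) self_mem_Ici ht ht

/-- The fundamental theorem of calculus on `[0, ∞)`, one-sided at the endpoint. -/
lemma ContinuousOn.hasDerivWithinAt_integral_Ici {f : ℝ → ℝ} (hf : ContinuousOn f (Ici 0))
    {t : ℝ} (ht : t ∈ Ici (0 : ℝ)) :
    HasDerivWithinAt (fun x => ∫ s in (0 : ℝ)..x, f s) (f t) (Ici 0) t := by
  have hg : Continuous fun x => f (max 0 x) :=
    hf.comp_continuous (by fun_prop) fun x => le_max_left 0 x
  have hint : ∀ x ∈ Ici (0 : ℝ), ∫ s in (0 : ℝ)..x, f s = ∫ s in (0 : ℝ)..x, f (max 0 s) := by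
    intro x hx
    refine intervalIntegral.integral_congr fun s hs => ?_
    rw [uIcc_of_le hx] at hs
    simp only [max_eq_right hs.1]
  have hder := (hg.integral_hasStrictDerivAt 0 t).hasDerivAt.hasDerivWithinAt (s := Ici 0)
  rw [max_eq_right ht] at hder
  exact hder.congr hint (hint t ht)

/-- A solution of `B'' = q B` with `q ≥ 0`, `B 0 = 1` and `B' 0 = 0` stays at least `1`. -/
lemma one_le_of_hasDerivWithinAt_Ici {q B B' : ℝ → ℝ} (hq : ∀ t, 0 ≤ q t)
    (hB : ∀ t ∈ Ici (0 : ℝ), HasDerivWithinAt B (B' t) (Ici 0) t)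
    (hB' : ∀ t ∈ Ici (0 : ℝ), HasDerivWithinAt B' (q t * B t) (Ici 0) t)
    (hB0 : B 0 = 1) (hB'0 : B' 0 = 0) {t : ℝ} (ht : t ∈ Ici (0 : ℝ)) : 1 ≤ B t := by
  have hprod : ∀ t ∈ Ici (0 : ℝ), 0 ≤ B t * B' t := by
    intro t ht
    have h := le_of_hasDerivWithinAt_Ici_nonneg (fun t ht => (hB t ht).mul (hB' t ht))
      (fun t _ => by nlinarith [mul_nonneg (hq t) (sq_nonneg (B t)), sq_nonneg (B' t)]) ht
    simpa [hB'0] using h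
  have hsq : ∀ t ∈ Ici (0 : ℝ), 1 ≤ B t * B t := by
    intro t ht
    have h := le_of_hasDerivWithinAt_Ici_nonneg (fun t ht => (hB t ht).mul (hB t ht))
      (fun t ht => by linarith [hprod t ht]) ht
    simpa [hB0] using h
  have hpos : 0 < B t := by
    by_contra! hle
    have hcont : ContinuousOn B (Icc 0 t) :=
      fun x hx => (hB x hx.1).continuousWithinAt.mono Icc_subset_Ici_self
    obtain ⟨x, hx, hx0⟩ := intermediate_value_Icc' ht hcont ⟨hle, by simp [hB0]⟩
    have h := hsq x hx.1
    norm_num [hx0] at h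
  nlinarith [hsq t ht]

/-- Hong's inequality (1.8): for the Gauss equation `B'' = κ²·B` with
`B(0) = 1`, `B'(0) = 0`, one has `B ≥ 1` and
`∫₀^t κ² ≤ B'(t) ≤ (∫₀^t κ²)·exp(∫₀^t s·κ(s)² ds)`. -/
theorem stmt9 (κ B B' B'' : ℝ → ℝ)
    (hκ_cont : ContinuousOn κ (Set.Ici 0))
    (hB''_cont : ContinuousOn B'' (Set.Ici 0))
    (hd1 : ∀ t ∈ Set.Ici (0:ℝ), HasDerivWithinAt B (B' t) (Set.Ici 0) t)
    (hd2 : ∀ t ∈ Set.Ici (0:ℝ), HasDerivWithinAt B' (B'' t) (Set.Ici 0) t)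
    (hB0 : B 0 = 1) (hB'0 : B' 0 = 0)
    (heq : ∀ t ∈ Set.Ici (0:ℝ), B'' t = κ t ^ 2 * B t) :
    (∀ t ∈ Set.Ici (0:ℝ), 1 ≤ B t) ∧
    ∀ t ∈ Set.Ici (0:ℝ),
      (∫ s in (0:ℝ)..t, κ s ^ 2) ≤ B' t ∧
      B' t ≤ (∫ s in (0:ℝ)..t, κ s ^ 2) * Real.exp (∫ s in (0:ℝ)..t, s * κ s ^ 2) := by
  have hd2' : ∀ t ∈ Ici (0 : ℝ), HasDerivWithinAt B' (κ t ^ 2 * B t) (Ici 0) t :=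
    fun t ht => heq t ht ▸ hd2 t ht
  have hB1 : ∀ t ∈ Ici (0 : ℝ), 1 ≤ B t := fun t ht =>
    one_le_of_hasDerivWithinAt_Ici (fun t => sq_nonneg (κ t)) hd1 hd2' hB0 hB'0 ht
  have hK : ∀ t ∈ Ici (0 : ℝ),
      HasDerivWithinAt (fun x => ∫ s in (0 : ℝ)..x, κ s ^ 2) (κ t ^ 2) (Ici 0) t :=
    fun t ht => (hκ_cont.pow 2).hasDerivWithinAt_integral_Ici ht
  have hM : ∀ t ∈ Ici (0 : ℝ),
      HasDerivWithinAt (fun x => ∫ s in (0 : ℝ)..x, s * κ s ^ 2) (t * κ t ^ 2) (Ici 0) t :=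
    fun t ht => (continuousOn_id.mul (hκ_cont.pow 2)).hasDerivWithinAt_integral_Ici ht
  refine ⟨hB1, fun t ht => ⟨?_, ?_⟩⟩
  · have h := le_of_hasDerivWithinAt_Ici_nonneg (fun t ht => (hd2' t ht).sub (hK t ht))
      (fun t ht => by nlinarith [mul_nonneg (sq_nonneg (κ t)) (sub_nonneg.2 (hB1 t ht))]) ht
    simpa [hB'0] using h
  · have htangent : ∀ t ∈ Ici (0 : ℝ), B t - t * B' t ≤ 1 := by
      intro t ht
      have h := le_of_hasDerivWithinAt_Ici_nonneg
        (fun t ht => ((hasDerivWithinAt_id t _).mul (hd2' t ht)).sub (hd1 t ht))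
        (fun t (ht : 0 ≤ t) => by
          have := mul_nonneg ht (mul_nonneg (sq_nonneg (κ t)) (zero_le_one.trans (hB1 t ht)))
          simpa using this) ht
      simp [hB0] at h
      linarith
    have hMnonneg : ∀ t ∈ Ici (0 : ℝ), 0 ≤ ∫ s in (0 : ℝ)..t, s * κ s ^ 2 := fun t ht =>
      intervalIntegral.integral_nonneg ht fun s hs => mul_nonneg hs.1 (sq_nonneg _)
    have h := le_of_hasDerivWithinAt_Ici_nonneg
      (fun t ht => (hK t ht).sub ((hd2' t ht).mul (hM t ht).neg.exp))
      (fun t ht => by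
        simp only [Pi.neg_apply]
        set E := Real.exp (-∫ s in (0 : ℝ)..t, s * κ s ^ 2)
        have hE : E ≤ 1 := Real.exp_le_one_iff.2 (neg_nonpos.2 (hMnonneg t ht))
        have hE0 : 0 ≤ E := (Real.exp_pos _).le
        have h1 : E * (B t - t * B' t) ≤ 1 := by nlinarith [htangent t ht]
        nlinarith [mul_nonneg (sq_nonneg (κ t)) (sub_nonneg.2 h1)]) ht
    simp only [Pi.sub_apply, Pi.mul_apply, Pi.neg_apply, intervalIntegral.integral_same, hB'0,
      zero_mul, sub_zero, Real.exp_neg, sub_nonneg] at h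
    rwa [← div_eq_mul_inv, div_le_iff₀ (Real.exp_pos _)] at h
end

section
/- Let B, κ : ℝ² → ℝ be continuously differentiable with B(x,t) > 0 and κ(x,t) > 0 everywhere, where ∂_x and ∂_t denote the partial derivatives in the first and second variables. Let r, s : ℝ² → ℝ be differentiable with s(x,t) > r(x,t) everywhere, and suppose that at every point: ∂_t r + s·∂_x r = ((r − s)/2)·(∂_t κ/κ + r·∂_x κ/κ) − (r + s)·∂_t B/B − r·s·∂_x B/B − B·(∂_t B)·r²·s, and ∂_t s + r·∂_x s = ((s − r)/2)·(∂_t κ/κ + s·∂_x κ/κ) − (r + s)·∂_t B/B − r·s·∂_x B/B − B·(∂_t B)·r·s². Define L = 2Bκ/(s − r), M = −(s + r)Bκ/(s − r), and N = 2·r·s·Bκ/(s − r). Then at every point: ∂_t L − ∂_x M = L·∂_t B/B − M·∂_x B/B + N·B·∂_t B, ∂_t M − ∂_x N = −M·∂_t B/B, and L·N − M² = −κ²·B². -/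
/-- Partial derivative in the first variable of a function of two real variables. -/
noncomputable def pdx (f : ℝ → ℝ → ℝ) (x t : ℝ) : ℝ := deriv (fun x' => f x' t) x

/-- Partial derivative in the second variable of a function of two real variables. -/
noncomputable def pdt (f : ℝ → ℝ → ℝ) (x t : ℝ) : ℝ := deriv (fun t' => f x t') t

/-- Coefficient `L = 2Bκ/(s−r)` of the second fundamental form. -/
noncomputable def Lf (B κ r s : ℝ → ℝ → ℝ) : ℝ → ℝ → ℝ :=
  fun x t => 2 * B x t * κ x t / (s x t - r x t)

/-- Coefficient `M = −(s+r)Bκ/(s−r)` of the second fundamental form. -/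
noncomputable def Mf (B κ r s : ℝ → ℝ → ℝ) : ℝ → ℝ → ℝ :=
  fun x t => -(s x t + r x t) * B x t * κ x t / (s x t - r x t)

/-- Coefficient `N = 2rsBκ/(s−r)` of the second fundamental form. -/
noncomputable def Nf (B κ r s : ℝ → ℝ → ℝ) : ℝ → ℝ → ℝ :=
  fun x t => 2 * r x t * s x t * B x t * κ x t / (s x t - r x t)

/-- A jointly differentiable function has its first partial derivative. -/
lemma hasDerivAt_pdx {f : ℝ → ℝ → ℝ} (hf : Differentiable ℝ (fun p : ℝ × ℝ => f p.1 p.2))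
    (x t : ℝ) : HasDerivAt (fun x' => f x' t) (pdx f x t) x :=
  (hf.comp (differentiable_id.prodMk (differentiable_const t)) x).hasDerivAt

/-- A jointly differentiable function has its second partial derivative. -/
lemma hasDerivAt_pdt {f : ℝ → ℝ → ℝ} (hf : Differentiable ℝ (fun p : ℝ × ℝ => f p.1 p.2))
    (x t : ℝ) : HasDerivAt (fun t' => f x t') (pdt f x t) t :=
  (hf.comp ((differentiable_const x).prodMk differentiable_id) t).hasDerivAt

/-- If the Riemann invariants `r < s` solve the Riemann-invariant form of the
Gauss–Codazzi system in geodesic coordinates for the metric `B² dx² + dt²`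
with curvature `K = −κ²`, then `L = 2Bκ/(s−r)`, `M = −(s+r)Bκ/(s−r)`,
`N = 2rsBκ/(s−r)` satisfy the Codazzi equations and the Gauss equation. -/
theorem stmt10 (B κ r s : ℝ → ℝ → ℝ)
    (hB : ContDiff ℝ 1 (fun p : ℝ × ℝ => B p.1 p.2))
    (hκ : ContDiff ℝ 1 (fun p : ℝ × ℝ => κ p.1 p.2))
    (hBpos : ∀ x t, 0 < B x t) (hκpos : ∀ x t, 0 < κ x t)
    (hr : Differentiable ℝ (fun p : ℝ × ℝ => r p.1 p.2))
    (hs : Differentiable ℝ (fun p : ℝ × ℝ => s p.1 p.2))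
    (hlt : ∀ x t, r x t < s x t)
    (heq1 : ∀ x t,
      pdt r x t + s x t * pdx r x t =
        (r x t - s x t) / 2 * (pdt κ x t / κ x t + r x t * (pdx κ x t / κ x t))
        - (r x t + s x t) * (pdt B x t / B x t)
        - r x t * s x t * (pdx B x t / B x t)
        - B x t * pdt B x t * (r x t) ^ 2 * s x t)
    (heq2 : ∀ x t,
      pdt s x t + r x t * pdx s x t =
        (s x t - r x t) / 2 * (pdt κ x t / κ x t + s x t * (pdx κ x t / κ x t))
        - (r x t + s x t) * (pdt B x t / B x t)
        - r x t * s x t * (pdx B x t / B x t)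
        - B x t * pdt B x t * r x t * (s x t) ^ 2) :
    ∀ x t,
      (pdt (Lf B κ r s) x t - pdx (Mf B κ r s) x t =
        Lf B κ r s x t * (pdt B x t / B x t)
        - Mf B κ r s x t * (pdx B x t / B x t)
        + Nf B κ r s x t * B x t * pdt B x t) ∧
      (pdt (Mf B κ r s) x t - pdx (Nf B κ r s) x t =
        -(Mf B κ r s x t) * (pdt B x t / B x t)) ∧
      (Lf B κ r s x t * Nf B κ r s x t - (Mf B κ r s x t) ^ 2 =
        -(κ x t ^ 2 * B x t ^ 2)) := by
  intro x t
  have hBd := hB.differentiable one_ne_zero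
  have hκd := hκ.differentiable one_ne_zero
  have hD : s x t - r x t ≠ 0 := (sub_pos.2 (hlt x t)).ne'
  have hB0 : B x t ≠ 0 := (hBpos x t).ne'
  have hκ0 : κ x t ≠ 0 := (hκpos x t).ne'
  have hBx := hasDerivAt_pdx hBd x t
  have hBt := hasDerivAt_pdt hBd x t
  have hκx := hasDerivAt_pdx hκd x t
  have hκt := hasDerivAt_pdt hκd x t
  have hrx := hasDerivAt_pdx hr x t
  have hrt := hasDerivAt_pdt hr x t
  have hsx := hasDerivAt_pdx hs x t
  have hst := hasDerivAt_pdt hs x t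
  have hLt : pdt (Lf B κ r s) x t = _ :=
    (((hBt.const_mul 2).mul hκt).div (hst.sub hrt) hD).deriv
  have hMx : pdx (Mf B κ r s) x t = _ :=
    ((((hsx.add hrx).neg.mul hBx).mul hκx).div (hsx.sub hrx) hD).deriv
  have hMt : pdt (Mf B κ r s) x t = _ :=
    ((((hst.add hrt).neg.mul hBt).mul hκt).div (hst.sub hrt) hD).deriv
  have hNx : pdx (Nf B κ r s) x t = _ :=
    (((((hrx.const_mul 2).mul hsx).mul hBx).mul hκx).div (hsx.sub hrx) hD).deriv
  have hr_t := eq_sub_of_add_eq (heq1 x t)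
  have hs_t := eq_sub_of_add_eq (heq2 x t)
  refine ⟨?_, ?_, ?_⟩
  · rw [hLt, hMx]
    simp only [Lf, Mf, Nf, Pi.add_apply, Pi.sub_apply, Pi.mul_apply, Pi.neg_apply]
    rw [hr_t, hs_t]
    field_simp
    ring
  · rw [hMt, hNx]
    simp only [Mf, Pi.add_apply, Pi.sub_apply, Pi.mul_apply, Pi.neg_apply]
    rw [hr_t, hs_t]
    field_simp
    ring
  · simp only [Lf, Mf, Nf]
    field_simp
    ring
end

section
/- Let Ω ⊆ ℝ × (0, ∞) be an open set with variables denoted (θ, ρ), let G, k : Ω → ℝ be continuously differentiable with G > 0 and k > 0 on Ω, where ∂_θ and ∂_ρ denote the partial derivatives in the first and second variables. Let w, z : Ω → ℝ be differentiable with z(θ,ρ) > w(θ,ρ) on Ω, and suppose that at every point of Ω: ∂_ρ w + z·∂_θ w = ((w − z)/2)·(∂_ρ k/k + w·∂_θ k/k) − (w + z)·∂_ρ G/G − w·z·∂_θ G/G − G·(∂_ρ G)·w²·z, and ∂_ρ z + w·∂_θ z = ((z − w)/2)·(∂_ρ k/k + z·∂_θ k/k) − (w + z)·∂_ρ G/G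 − w·z·∂_θ G/G − G·(∂_ρ G)·w·z². Define L̃ = 2Gk/(z − w), M̃ = −(z + w)Gk/(z − w), and Ñ = 2·w·z·Gk/(z − w). Then at every point of Ω: ∂_ρ L̃ − ∂_θ M̃ = L̃·∂_ρ G/G − M̃·∂_θ G/G + Ñ·G·∂_ρ G, ∂_ρ M̃ − ∂_θ Ñ = −M̃·∂_ρ G/G, and L̃·Ñ − M̃² = −k²·G². -/
/-- Partial derivative in the first (angular) variable. -/
noncomputable def pdθ (f : ℝ → ℝ → ℝ) (θ ρ : ℝ) : ℝ := deriv (fun θ' => f θ' ρ) θ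

/-- Partial derivative in the second (radial) variable. -/
noncomputable def pdρ (f : ℝ → ℝ → ℝ) (θ ρ : ℝ) : ℝ := deriv (fun ρ' => f θ ρ') ρ

/-- Coefficient `L̃ = 2Gk/(z−w)` of the second fundamental form. -/
noncomputable def Lt (G k w z : ℝ → ℝ → ℝ) : ℝ → ℝ → ℝ :=
  fun θ ρ => 2 * G θ ρ * k θ ρ / (z θ ρ - w θ ρ)

/-- Coefficient `M̃ = −(z+w)Gk/(z−w)` of the second fundamental form. -/
noncomputable def Mt (G k w z : ℝ → ℝ → ℝ) : ℝ → ℝ → ℝ :=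
  fun θ ρ => -(z θ ρ + w θ ρ) * G θ ρ * k θ ρ / (z θ ρ - w θ ρ)

/-- Coefficient `Ñ = 2wzGk/(z−w)` of the second fundamental form. -/
noncomputable def Nt (G k w z : ℝ → ℝ → ℝ) : ℝ → ℝ → ℝ :=
  fun θ ρ => 2 * w θ ρ * z θ ρ * G θ ρ * k θ ρ / (z θ ρ - w θ ρ)

/-- A function differentiable on an open set has a partial derivative in the first variable. -/
lemma hasDerivAt_pdθ {Ω : Set (ℝ × ℝ)} (hΩ : IsOpen Ω) {f : ℝ → ℝ → ℝ}
    (hf : DifferentiableOn ℝ (fun p : ℝ × ℝ => f p.1 p.2) Ω) {θ ρ : ℝ} (h : (θ, ρ) ∈ Ω) :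
    HasDerivAt (fun t => f t ρ) (pdθ f θ ρ) θ := by
  have hd : DifferentiableAt ℝ (fun p : ℝ × ℝ => f p.1 p.2) (θ, ρ) :=
    hf.differentiableAt (hΩ.mem_nhds h)
  have hc : DifferentiableAt ℝ (fun t : ℝ => (t, ρ)) θ := by fun_prop
  exact (DifferentiableAt.comp θ hd hc).hasDerivAt

/-- A function differentiable on an open set has a partial derivative in the second variable. -/
lemma hasDerivAt_pdρ {Ω : Set (ℝ × ℝ)} (hΩ : IsOpen Ω) {f : ℝ → ℝ → ℝ}
    (hf : DifferentiableOn ℝ (fun p : ℝ × ℝ => f p.1 p.2) Ω) {θ ρ : ℝ} (h : (θ, ρ) ∈ Ω) :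
    HasDerivAt (fun r => f θ r) (pdρ f θ ρ) ρ := by
  have hd : DifferentiableAt ℝ (fun p : ℝ × ℝ => f p.1 p.2) (θ, ρ) :=
    hf.differentiableAt (hΩ.mem_nhds h)
  have hc : DifferentiableAt ℝ (fun r : ℝ => (θ, r)) ρ := by fun_prop
  exact (DifferentiableAt.comp ρ hd hc).hasDerivAt

/-- If the Riemann invariants `w < z` solve the Riemann-invariant form of the
Gauss–Codazzi system in geodesic polar coordinates on an open set
`Ω ⊆ ℝ × (0,∞)` for the metric `G² dθ² + dρ²` with curvature `K = −k²`, then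
`L̃ = 2Gk/(z−w)`, `M̃ = −(z+w)Gk/(z−w)`, `Ñ = 2wzGk/(z−w)` satisfy the Codazzi
equations and the Gauss equation on `Ω`. -/
theorem stmt11 (Ω : Set (ℝ × ℝ)) (hΩ : IsOpen Ω)
    (hΩsub : Ω ⊆ {p : ℝ × ℝ | 0 < p.2})
    (G k w z : ℝ → ℝ → ℝ)
    (hG : ContDiffOn ℝ 1 (fun p : ℝ × ℝ => G p.1 p.2) Ω)
    (hk : ContDiffOn ℝ 1 (fun p : ℝ × ℝ => k p.1 p.2) Ω)
    (hGpos : ∀ θ ρ, (θ, ρ) ∈ Ω → 0 < G θ ρ)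
    (hkpos : ∀ θ ρ, (θ, ρ) ∈ Ω → 0 < k θ ρ)
    (hw : DifferentiableOn ℝ (fun p : ℝ × ℝ => w p.1 p.2) Ω)
    (hz : DifferentiableOn ℝ (fun p : ℝ × ℝ => z p.1 p.2) Ω)
    (hlt : ∀ θ ρ, (θ, ρ) ∈ Ω → w θ ρ < z θ ρ)
    (heq1 : ∀ θ ρ, (θ, ρ) ∈ Ω →
      pdρ w θ ρ + z θ ρ * pdθ w θ ρ =
        (w θ ρ - z θ ρ) / 2 * (pdρ k θ ρ / k θ ρ + w θ ρ * (pdθ k θ ρ / k θ ρ))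
        - (w θ ρ + z θ ρ) * (pdρ G θ ρ / G θ ρ)
        - w θ ρ * z θ ρ * (pdθ G θ ρ / G θ ρ)
        - G θ ρ * pdρ G θ ρ * (w θ ρ) ^ 2 * z θ ρ)
    (heq2 : ∀ θ ρ, (θ, ρ) ∈ Ω →
      pdρ z θ ρ + w θ ρ * pdθ z θ ρ =
        (z θ ρ - w θ ρ) / 2 * (pdρ k θ ρ / k θ ρ + z θ ρ * (pdθ k θ ρ / k θ ρ))
        - (w θ ρ + z θ ρ) * (pdρ G θ ρ / G θ ρ)
        - w θ ρ * z θ ρ * (pdθ G θ ρ / G θ ρ)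
        - G θ ρ * pdρ G θ ρ * w θ ρ * (z θ ρ) ^ 2) :
    ∀ θ ρ, (θ, ρ) ∈ Ω →
      (pdρ (Lt G k w z) θ ρ - pdθ (Mt G k w z) θ ρ =
        Lt G k w z θ ρ * (pdρ G θ ρ / G θ ρ)
        - Mt G k w z θ ρ * (pdθ G θ ρ / G θ ρ)
        + Nt G k w z θ ρ * G θ ρ * pdρ G θ ρ) ∧
      (pdρ (Mt G k w z) θ ρ - pdθ (Nt G k w z) θ ρ =
        -(Mt G k w z θ ρ) * (pdρ G θ ρ / G θ ρ)) ∧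
      (Lt G k w z θ ρ * Nt G k w z θ ρ - (Mt G k w z θ ρ) ^ 2 =
        -(k θ ρ ^ 2 * G θ ρ ^ 2)) := by
  intro θ ρ h
  have hG0 := (hGpos θ ρ h).ne'
  have hk0 := (hkpos θ ρ h).ne'
  have hD0 : z θ ρ - w θ ρ ≠ 0 := (sub_pos.2 (hlt θ ρ h)).ne'
  have hGd := hG.differentiableOn one_ne_zero
  have hkd := hk.differentiableOn one_ne_zero
  have Gθ := hasDerivAt_pdθ hΩ hGd h
  have kθ := hasDerivAt_pdθ hΩ hkd h
  have wθ := hasDerivAt_pdθ hΩ hw h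
  have zθ := hasDerivAt_pdθ hΩ hz h
  have Gρ := hasDerivAt_pdρ hΩ hGd h
  have kρ := hasDerivAt_pdρ hΩ hkd h
  have wρ := hasDerivAt_pdρ hΩ hw h
  have zρ := hasDerivAt_pdρ hΩ hz h
  have Lρ : pdρ (Lt G k w z) θ ρ = _ :=
    (((Gρ.const_mul 2).fun_mul kρ).fun_div (zρ.fun_sub wρ) hD0).deriv
  have Mρ : pdρ (Mt G k w z) θ ρ = _ :=
    ((((zρ.fun_add wρ).fun_neg.fun_mul Gρ).fun_mul kρ).fun_div (zρ.fun_sub wρ) hD0).deriv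
  have Mθ : pdθ (Mt G k w z) θ ρ = _ :=
    ((((zθ.fun_add wθ).fun_neg.fun_mul Gθ).fun_mul kθ).fun_div (zθ.fun_sub wθ) hD0).deriv
  have Nθ : pdθ (Nt G k w z) θ ρ = _ :=
    (((((wθ.const_mul 2).fun_mul zθ).fun_mul Gθ).fun_mul kθ).fun_div (zθ.fun_sub wθ) hD0).deriv
  have hwρ := eq_sub_of_add_eq (heq1 θ ρ h)
  have hzρ := eq_sub_of_add_eq (heq2 θ ρ h)
  rw [Lρ, Mρ, Mθ, Nθ, hwρ, hzρ]
  simp only [Lt, Mt, Nt]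
  refine ⟨?_, ?_, ?_⟩ <;> field_simp <;> ring
end

section
/- Let α, β ∈ ℝ, let R < T be real numbers, and let G, k, u, v : [R, T] → ℝ be differentiable functions with G > 0, k > 0, and v > 0 on [R, T], satisfying on [R, T]: u' + u·((2 − α)·G'/G + β·k'/k) + (1/4)·G^{1−2α}·G'·k^{2β}·(u² − v²)·u = 0 and v' + v·(−α·G'/G + (β − 1)·k'/k) + (1/4)·G^{1−2α}·G'·k^{2β}·(u² − v²)·v = 0, where powers are real powers of positive reals. Then the function ρ ↦ G(ρ)²·k(ρ)·u(ρ)/v(ρ) is constant on [R, T]. -/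
/-- ODE reduction of the symmetric hyperbolic system: if `u, v` (with `v > 0`)
satisfy the reduced ODE system on `[R, T]`, then `G²·k·u/v` is constant. -/
theorem stmt13 (α β R T : ℝ) (hRT : R < T)
    (G k u v G' k' u' v' : ℝ → ℝ)
    (hGd : ∀ ρ ∈ Set.Icc R T, HasDerivWithinAt G (G' ρ) (Set.Icc R T) ρ)
    (hkd : ∀ ρ ∈ Set.Icc R T, HasDerivWithinAt k (k' ρ) (Set.Icc R T) ρ)
    (hud : ∀ ρ ∈ Set.Icc R T, HasDerivWithinAt u (u' ρ) (Set.Icc R T) ρ)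
    (hvd : ∀ ρ ∈ Set.Icc R T, HasDerivWithinAt v (v' ρ) (Set.Icc R T) ρ)
    (hGpos : ∀ ρ ∈ Set.Icc R T, 0 < G ρ)
    (hkpos : ∀ ρ ∈ Set.Icc R T, 0 < k ρ)
    (hvpos : ∀ ρ ∈ Set.Icc R T, 0 < v ρ)
    (hequ : ∀ ρ ∈ Set.Icc R T,
      u' ρ + u ρ * ((2 - α) * G' ρ / G ρ + β * k' ρ / k ρ)
        + (1/4) * G ρ ^ (1 - 2*α) * G' ρ * k ρ ^ (2*β)
            * (u ρ ^ 2 - v ρ ^ 2) * u ρ = 0)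
    (heqv : ∀ ρ ∈ Set.Icc R T,
      v' ρ + v ρ * (-α * G' ρ / G ρ + (β - 1) * k' ρ / k ρ)
        + (1/4) * G ρ ^ (1 - 2*α) * G' ρ * k ρ ^ (2*β)
            * (u ρ ^ 2 - v ρ ^ 2) * v ρ = 0) :
    ∀ ρ ∈ Set.Icc R T, G ρ ^ 2 * k ρ * u ρ / v ρ = G R ^ 2 * k R * u R / v R := by
  have hd : ∀ ρ ∈ Set.Icc R T,
      HasDerivWithinAt (fun x => G x ^ 2 * k x * u x / v x) 0 (Set.Icc R T) ρ := by
    intro ρ hρ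
    have hG := (hGpos ρ hρ).ne'
    have hk := (hkpos ρ hρ).ne'
    have hv := (hvpos ρ hρ).ne'
    refine (((((hGd ρ hρ).fun_pow 2).fun_mul (hkd ρ hρ)).fun_mul (hud ρ hρ)).fun_div
      (hvd ρ hρ) hv).congr_deriv ?_
    have hu' := eq_neg_of_add_eq_zero_left ((add_assoc _ _ _).symm.trans (hequ ρ hρ))
    have hv' := eq_neg_of_add_eq_zero_left ((add_assoc _ _ _).symm.trans (heqv ρ hρ))
    rw [hu', hv']
    generalize G ρ ^ (1 - 2 * α) = p
    generalize k ρ ^ (2 * β) = q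
    field_simp
    push_cast
    ring
  exact constant_of_derivWithin_zero (fun ρ hρ => (hd ρ hρ).differentiableWithinAt)
    fun ρ hρ => (hd ρ (Set.Ico_subset_Icc_self hρ)).derivWithin
      (uniqueDiffOn_Icc hRT ρ (Set.Ico_subset_Icc_self hρ))
end

section
/- Let α, β ∈ ℝ, let R < T be real numbers, let G : [R, T] → ℝ be twice continuously differentiable and k, u, v : [R, T] → ℝ be differentiable with G > 0, k > 0, v > 0 on [R, T], satisfying G'' = k²·G on [R, T] together with: u' + u·((2 − α)·G'/G + β·k'/k) + (1/4)·G^{1−2α}·G'·k^{2β}·(u² − v²)·u = 0 and v' + v·(−α·G'/G + (β − 1)·k'/k) + (1/4)·G^{1−2α}·G'·k^{2β}·(u² − v²)·v = 0, where powers are real powers of positive reals. Set c = G(R)²·k(R)·u(R)/v(R). Then the function ρ ↦ G(ρ)^{2α}·k(ρ)^{2−2β}·v(ρ)^{−2} + c²/(4·G(ρ)²) + G'(ρ)²/4 is constant on [R, T]. -/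
/-- A function with vanishing one-sided derivative along `[a, b]` is constant there. -/
theorem eq_left_of_hasDerivWithinAt_Icc_zero {f : ℝ → ℝ} {a b : ℝ} (hab : a < b)
    (hf : ∀ x ∈ Set.Icc a b, HasDerivWithinAt f 0 (Set.Icc a b) x) :
    ∀ x ∈ Set.Icc a b, f x = f a :=
  constant_of_derivWithin_zero (fun x hx => (hf x hx).differentiableWithinAt) fun x hx =>
    (hf x (Set.Ico_subset_Icc_self hx)).derivWithin
      (uniqueDiffOn_Icc hab x (Set.Ico_subset_Icc_self hx))

/-- First integral for the ODE reduction: if moreover `G'' = k²·G` (the Gauss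
equation) holds, then with `c = G(R)²·k(R)·u(R)/v(R)` the quantity
`G^{2α}·k^{2−2β}·v^{−2} + c²/(4G²) + G'²/4` is constant on `[R, T]`. -/
theorem stmt14 (α β R T : ℝ) (hRT : R < T)
    (G k u v G' G'' k' u' v' : ℝ → ℝ)
    (hGd : ∀ ρ ∈ Set.Icc R T, HasDerivWithinAt G (G' ρ) (Set.Icc R T) ρ)
    (hGd2 : ∀ ρ ∈ Set.Icc R T, HasDerivWithinAt G' (G'' ρ) (Set.Icc R T) ρ)
    (hG''c : ContinuousOn G'' (Set.Icc R T))
    (hkd : ∀ ρ ∈ Set.Icc R T, HasDerivWithinAt k (k' ρ) (Set.Icc R T) ρ)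
    (hud : ∀ ρ ∈ Set.Icc R T, HasDerivWithinAt u (u' ρ) (Set.Icc R T) ρ)
    (hvd : ∀ ρ ∈ Set.Icc R T, HasDerivWithinAt v (v' ρ) (Set.Icc R T) ρ)
    (hGpos : ∀ ρ ∈ Set.Icc R T, 0 < G ρ)
    (hkpos : ∀ ρ ∈ Set.Icc R T, 0 < k ρ)
    (hvpos : ∀ ρ ∈ Set.Icc R T, 0 < v ρ)
    (hGauss : ∀ ρ ∈ Set.Icc R T, G'' ρ = k ρ ^ 2 * G ρ)
    (hequ : ∀ ρ ∈ Set.Icc R T,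
      u' ρ + u ρ * ((2 - α) * G' ρ / G ρ + β * k' ρ / k ρ)
        + (1/4) * G ρ ^ (1 - 2*α) * G' ρ * k ρ ^ (2*β)
            * (u ρ ^ 2 - v ρ ^ 2) * u ρ = 0)
    (heqv : ∀ ρ ∈ Set.Icc R T,
      v' ρ + v ρ * (-α * G' ρ / G ρ + (β - 1) * k' ρ / k ρ)
        + (1/4) * G ρ ^ (1 - 2*α) * G' ρ * k ρ ^ (2*β)
            * (u ρ ^ 2 - v ρ ^ 2) * v ρ = 0)
    (c : ℝ) (hc : c = G R ^ 2 * k R * u R / v R) :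
    ∀ ρ ∈ Set.Icc R T,
      G ρ ^ (2*α) * k ρ ^ (2 - 2*β) / v ρ ^ 2 + c ^ 2 / (4 * G ρ ^ 2)
          + G' ρ ^ 2 / 4 =
        G R ^ (2*α) * k R ^ (2 - 2*β) / v R ^ 2 + c ^ 2 / (4 * G R ^ 2)
          + G' R ^ 2 / 4 := by
  have hcons : ∀ ρ ∈ Set.Icc R T, G ρ ^ 2 * k ρ * u ρ / v ρ = c := by
    rw [hc]
    refine eq_left_of_hasDerivWithinAt_Icc_zero
      (f := fun ρ => G ρ ^ 2 * k ρ * u ρ / v ρ) hRT fun ρ hρ => ?_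
    have hG := (hGpos ρ hρ).ne'
    have hk := (hkpos ρ hρ).ne'
    have hv := (hvpos ρ hρ).ne'
    refine (((((hGd ρ hρ).fun_pow 2).fun_mul (hkd ρ hρ)).fun_mul (hud ρ hρ)).fun_div
      (hvd ρ hρ) hv).congr_deriv ?_
    rw [eq_sub_of_add_eq (eq_neg_of_add_eq_zero_left (hequ ρ hρ)),
      eq_sub_of_add_eq (eq_neg_of_add_eq_zero_left (heqv ρ hρ))]
    field_simp
    push_cast
    ring
  refine eq_left_of_hasDerivWithinAt_Icc_zero (f := fun ρ =>
    G ρ ^ (2*α) * k ρ ^ (2 - 2*β) / v ρ ^ 2 + c ^ 2 / (4 * G ρ ^ 2) + G' ρ ^ 2 / 4)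
    hRT fun ρ hρ => ?_
  have hG := hGpos ρ hρ
  have hk := hkpos ρ hρ
  have hv := hvpos ρ hρ
  have hGα : G ρ ^ (2*α) ≠ 0 := (Real.rpow_pos_of_pos hG _).ne'
  have hkβ : k ρ ^ (2*β) ≠ 0 := (Real.rpow_pos_of_pos hk _).ne'
  have hG_inv : G ρ ^ (1 - 2*α) = G ρ / G ρ ^ (2*α) := by
    rw [Real.rpow_sub hG, Real.rpow_one]
  have hk_inv : k ρ ^ (2 - 2*β) = k ρ ^ 2 / k ρ ^ (2*β) := by
    rw [Real.rpow_sub hk, Real.rpow_two]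
  refine (((((hGd ρ hρ).rpow_const (p := 2*α) (Or.inl hG.ne')).fun_mul
      ((hkd ρ hρ).rpow_const (p := 2 - 2*β) (Or.inl hk.ne'))).fun_div
        ((hvd ρ hρ).fun_pow 2) (pow_ne_zero 2 hv.ne')).fun_add
      ((hasDerivWithinAt_const ρ _ (c ^ 2)).fun_div (((hGd ρ hρ).fun_pow 2).const_mul 4)
        (by positivity))).fun_add (((hGd2 ρ hρ).fun_pow 2).div_const 4) |>.congr_deriv ?_
  have hv' := eq_sub_of_add_eq (eq_neg_of_add_eq_zero_left (heqv ρ hρ))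
  rw [hG_inv] at hv'
  rw [hv', ← hcons ρ hρ, hGauss ρ hρ, Real.rpow_sub_one hG.ne', Real.rpow_sub_one hk.ne', hk_inv]
  have hG0 := hG.ne'
  have hk0 := hk.ne'
  have hv0 := hv.ne'
  generalize G ρ ^ (2*α) = A at *
  generalize k ρ ^ (2*β) = B at *
  field_simp
  push_cast
  ring
end

section
/- Let R < R' be real numbers, let b, F : ℝ × [R, R'] → ℝ be continuous functions such that b is bounded and there is a constant L with |b(θ₁, ρ) − b(θ₂, ρ)| ≤ L·|θ₁ − θ₂| for all θ₁, θ₂ ∈ ℝ and ρ ∈ [R, R'], and let v : ℝ × [R, R'] → ℝ be continuously differentiable satisfying ∂_ρ v(θ, ρ) + b(θ, ρ)·∂_θ v(θ, ρ) = F(θ, ρ)·v(θ, ρ) for all (θ, ρ) ∈ ℝ × [R, R']. If v(θ, R) > 0 for every θ ∈ ℝ, then v(θ, ρ) > 0 for every (θ, ρ) ∈ ℝ × [R, R']. -/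
open Set Filter Topology

/-- Two-point mean value theorem with the intermediate point bounded by the displacement. -/
lemma exists_sub_eq_deriv_mul_sub {f f' : ℝ → ℝ} (hf : ∀ x, HasDerivAt f (f' x) x) (x y : ℝ) :
    ∃ ξ, |ξ - x| ≤ |y - x| ∧ f y - f x = f' ξ * (y - x) := by
  have hcont : Continuous f := continuous_iff_continuousAt.2 fun z => (hf z).continuousAt
  rcases lt_trichotomy x y with hxy | rfl | hxy
  · obtain ⟨ξ, hξ, h⟩ :=
      exists_hasDerivAt_eq_slope f f' hxy hcont.continuousOn fun z _ => hf z
    refine ⟨ξ, ?_, ?_⟩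
    · rw [abs_of_pos (sub_pos.2 hξ.1), abs_of_pos (sub_pos.2 hxy)]
      linarith [hξ.2]
    · rw [h, div_mul_cancel₀ _ (sub_pos.2 hxy).ne']
  · exact ⟨x, by simp, by simp⟩
  · obtain ⟨ξ, hξ, h⟩ :=
      exists_hasDerivAt_eq_slope f f' hxy hcont.continuousOn fun z _ => hf z
    refine ⟨ξ, ?_, ?_⟩
    · rw [abs_of_neg (sub_neg.2 hξ.2), abs_of_neg (sub_neg.2 hxy)]
      linarith [hξ.1]
    · have := div_mul_cancel₀ (f x - f y) (sub_pos.2 hxy).ne'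
      rw [← h] at this
      linarith

/-- Chain rule along a curve `t ↦ (X t, t)` for a function on a strip `ℝ × s`. -/
lemma HasDerivWithinAt.comp_graph {v vθ : ℝ → ℝ → ℝ} {X : ℝ → ℝ} {s : Set ℝ} {t₀ X' c : ℝ}
    (hdθ : ∀ θ, ∀ t ∈ s, HasDerivAt (fun θ' => v θ' t) (vθ θ t) θ)
    (hvθ : ContinuousWithinAt (fun p : ℝ × ℝ => vθ p.1 p.2) (univ ×ˢ s) (X t₀, t₀))
    (hdt : HasDerivWithinAt (fun t => v (X t₀) t) c s t₀)
    (hX : HasDerivWithinAt X X' s t₀) :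
    HasDerivWithinAt (fun t => v (X t) t) (c + vθ (X t₀) t₀ * X') s t₀ := by
  have hmvt : ∀ t, ∃ ξ, t ∈ s →
      |ξ - X t₀| ≤ |X t - X t₀| ∧ v (X t) t - v (X t₀) t = vθ ξ t * (X t - X t₀) := by
    intro t
    by_cases ht : t ∈ s
    · obtain ⟨ξ, hξ⟩ := exists_sub_eq_deriv_mul_sub (fun θ => hdθ θ t ht) (X t₀) (X t)
      exact ⟨ξ, fun _ => hξ⟩
    · exact ⟨0, fun h => absurd h ht⟩
  choose ξ hξ using hmvt
  have hmem : ∀ᶠ t in 𝓝[s \ {t₀}] t₀, t ∈ s \ {t₀} := self_mem_nhdsWithin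
  have hle : 𝓝[s \ {t₀}] t₀ ≤ 𝓝[s] t₀ := nhdsWithin_mono _ sdiff_subset
  have hξ_lim : Tendsto ξ (𝓝[s \ {t₀}] t₀) (𝓝 (X t₀)) := by
    rw [tendsto_iff_norm_sub_tendsto_zero]
    refine squeeze_zero' (Eventually.of_forall fun _ => norm_nonneg _)
      (hmem.mono fun t ht => (hξ t ht.1).1) ?_
    exact tendsto_iff_norm_sub_tendsto_zero.1 (hX.continuousWithinAt.tendsto.mono_left hle)
  have hvθ_lim : Tendsto (fun t => vθ (ξ t) t) (𝓝[s \ {t₀}] t₀) (𝓝 (vθ (X t₀) t₀)) := by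
    refine Tendsto.comp (g := fun p : ℝ × ℝ => vθ p.1 p.2) hvθ (f := fun t => (ξ t, t))
      (tendsto_nhdsWithin_iff.2 ⟨?_, hmem.mono fun t ht => ⟨mem_univ _, ht.1⟩⟩)
    exact hξ_lim.prodMk_nhds (tendsto_id.mono_left nhdsWithin_le_nhds)
  rw [hasDerivWithinAt_iff_tendsto_slope] at hdt hX ⊢
  refine (hdt.add (hvθ_lim.mul hX)).congr' (hmem.mono fun t ht => ?_)
  simp only [slope_def_field]
  rw [mul_div_assoc', ← (hξ t ht.1).2, ← add_div]
  ring

/-- A bounded vector field on the line that is Lipschitz in space has a characteristic curve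
through every point of the strip, defined for all times. -/
lemma exists_characteristic {R R' : ℝ} {b : ℝ → ℝ → ℝ} {L C : ℝ}
    (hcont : ∀ θ, ContinuousOn (b θ) (Icc R R'))
    (hbdd : ∀ θ, ∀ ρ ∈ Icc R R', |b θ ρ| ≤ C)
    (hlip : ∀ θ₁ θ₂, ∀ ρ ∈ Icc R R', |b θ₁ ρ - b θ₂ ρ| ≤ L * |θ₁ - θ₂|)
    (θ : ℝ) {ρ : ℝ} (hρ : ρ ∈ Icc R R') :
    ∃ X : ℝ → ℝ, X ρ = θ ∧
      ∀ t ∈ Icc R R', HasDerivWithinAt X (b (X t) t) (Icc R R') t := by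
  have hRR' : 0 ≤ R' - R := sub_nonneg.2 (hρ.1.trans hρ.2)
  have hpl : IsPicardLindelof (fun t x => b x t) (⟨ρ, hρ⟩ : Icc R R') θ
      (C.toNNReal * (R' - R).toNNReal) 0 C.toNNReal L.toNNReal := by
    refine ⟨fun t ht => ?_, fun x _ => hcont x, fun t ht x _ => ?_, ?_⟩
    · refine (LipschitzWith.of_dist_le_mul fun x y => ?_).lipschitzOnWith
      rw [Real.dist_eq, Real.dist_eq]
      exact (hlip x y t ht).trans
        (mul_le_mul_of_nonneg_right (Real.le_coe_toNNReal L) (abs_nonneg _))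
    · exact (hbdd x t ht).trans (Real.le_coe_toNNReal C)
    · rw [NNReal.coe_mul, Real.coe_toNNReal _ hRR', NNReal.coe_zero, sub_zero]
      exact mul_le_mul_of_nonneg_left
        (max_le (by linarith [hρ.1]) (by linarith [hρ.2])) C.toNNReal.coe_nonneg
  exact hpl.exists_eq_forall_mem_Icc_hasDerivWithinAt₀

/-- Solutions of the scalar linear equation `f' = g f` on an interval stay positive. -/
lemma pos_of_hasDerivWithinAt_mul_self {a b : ℝ} {f g : ℝ → ℝ}
    (hg : ContinuousOn g (Icc a b))
    (hf : ∀ t ∈ Icc a b, HasDerivWithinAt f (g t * f t) (Icc a b) t)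
    (ha : 0 < f a) : ∀ t ∈ Icc a b, 0 < f t := by
  intro t ht
  by_contra! hneg
  have hfc : ContinuousOn f (Icc a b) := fun x hx => (hf x hx).continuousWithinAt
  obtain ⟨t₁, ht₁, hzero⟩ : (0 : ℝ) ∈ f '' Icc a t :=
    intermediate_value_Icc' ht.1 (hfc.mono (Icc_subset_Icc_right ht.2)) ⟨hneg, ha.le⟩
  have hsub : Icc a t₁ ⊆ Icc a b := Icc_subset_Icc_right (ht₁.2.trans ht.2)
  obtain ⟨K, hK⟩ := isCompact_Icc.exists_bound_of_continuousOn hg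
  have hlip : ∀ s ∈ Ioc a t₁, LipschitzOnWith K.toNNReal (fun x => g s * x) univ := by
    refine fun s hs => (LipschitzWith.of_dist_le_mul fun x y => ?_).lipschitzOnWith
    rw [Real.dist_eq, Real.dist_eq, ← mul_sub, abs_mul]
    exact mul_le_mul_of_nonneg_right
      ((hK s (hsub (Ioc_subset_Icc_self hs))).trans (Real.le_coe_toNNReal K)) (abs_nonneg _)
  have heq : EqOn f (fun _ => 0) (Icc a t₁) := by
    refine ODE_solution_unique_of_mem_Icc_left hlip (hfc.mono hsub) (fun s hs => ?_)
      (fun _ _ => mem_univ _) continuousOn_const (fun s _ => ?_) (fun _ _ => mem_univ _) hzero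
    · have hs' := hsub (Ioc_subset_Icc_self hs)
      exact (hf s hs').mono_of_mem_nhdsWithin
        (mem_of_superset (Icc_mem_nhdsLE hs.1) (Icc_subset_Icc_right hs'.2))
    · simpa using hasDerivWithinAt_const s (Iic s) (0 : ℝ)
  exact ha.ne' (heq ⟨le_rfl, ht₁.1⟩)


/-- Positivity propagation for the transport equation `∂_ρ v + b·∂_θ v = F·v`
on the strip `ℝ × [R, R']`: if `b` is continuous, bounded and Lipschitz in `θ`
uniformly in `ρ`, `F` is continuous, `v` is `C¹` and solves the equation, and
`v(·, R) > 0`, then `v > 0` on the whole strip. -/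
theorem stmt17 (R R' : ℝ) (hRR' : R < R')
    (b F v vθ vρ : ℝ → ℝ → ℝ) (L Cb : ℝ)
    (hb_cont : ContinuousOn (fun p : ℝ × ℝ => b p.1 p.2)
      (Set.univ ×ˢ Set.Icc R R'))
    (hb_bdd : ∀ θ : ℝ, ∀ ρ ∈ Set.Icc R R', |b θ ρ| ≤ Cb)
    (hb_lip : ∀ θ₁ θ₂ : ℝ, ∀ ρ ∈ Set.Icc R R',
      |b θ₁ ρ - b θ₂ ρ| ≤ L * |θ₁ - θ₂|)
    (hF_cont : ContinuousOn (fun p : ℝ × ℝ => F p.1 p.2)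
      (Set.univ ×ˢ Set.Icc R R'))
    (hvθ_cont : ContinuousOn (fun p : ℝ × ℝ => vθ p.1 p.2)
      (Set.univ ×ˢ Set.Icc R R'))
    (hvρ_cont : ContinuousOn (fun p : ℝ × ℝ => vρ p.1 p.2)
      (Set.univ ×ˢ Set.Icc R R'))
    (hdθ : ∀ θ : ℝ, ∀ ρ ∈ Set.Icc R R',
      HasDerivAt (fun θ' => v θ' ρ) (vθ θ ρ) θ)
    (hdρ : ∀ θ : ℝ, ∀ ρ ∈ Set.Icc R R',
      HasDerivWithinAt (fun ρ' => v θ ρ') (vρ θ ρ) (Set.Icc R R') ρ)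
    (heq : ∀ θ : ℝ, ∀ ρ ∈ Set.Icc R R',
      vρ θ ρ + b θ ρ * vθ θ ρ = F θ ρ * v θ ρ)
    (hv0 : ∀ θ : ℝ, 0 < v θ R) :
    ∀ θ : ℝ, ∀ ρ ∈ Set.Icc R R', 0 < v θ ρ := by
  intro θ ρ hρ
  obtain ⟨X, hXρ, hX⟩ := exists_characteristic
    (fun θ => hb_cont.comp (f := fun t => (θ, t)) (by fun_prop) fun t ht => ⟨mem_univ _, ht⟩)
    hb_bdd hb_lip θ hρ
  have hXc : ContinuousOn X (Icc R R') := fun t ht => (hX t ht).continuousWithinAt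
  have hF : ContinuousOn (fun t => F (X t) t) (Icc R R') :=
    hF_cont.comp (f := fun t => (X t, t)) (hXc.prodMk continuousOn_id)
      fun t ht => ⟨mem_univ _, ht⟩
  have hd : ∀ t ∈ Icc R R',
      HasDerivWithinAt (fun t => v (X t) t) (F (X t) t * v (X t) t) (Icc R R') t := by
    intro t ht
    rw [← heq (X t) t ht, mul_comm (b _ _)]
    exact HasDerivWithinAt.comp_graph hdθ (hvθ_cont _ ⟨mem_univ _, ht⟩)
      (hdρ (X t) t ht) (hX t ht)
  simpa only [hXρ] using pos_of_hasDerivWithinAt_mul_self hF hd (hv0 (X R)) ρ hρ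
end

section
/- Let δ > 0, A ≥ 0, and 0 < R < R' be real numbers, let φ : [R, R'] → [1, ∞) be a continuously differentiable nondecreasing function, and let y : [R, R'] → [0, ∞) be a continuously differentiable function satisfying y'(ρ) ≤ (−δ/ρ + 2·φ'(ρ)/φ(ρ))·y(ρ) + A·ρ^{−1−2δ} for all ρ ∈ [R, R']. Then y(ρ) ≤ φ(ρ)²·ρ^{−δ}·(y(R)·R^δ + A/(δ·R^δ)) for all ρ ∈ [R, R']. -/
/-- Weighted Gronwall-type decay lemma: if `y ≥ 0` satisfies
`y' ≤ (−δ/ρ + 2φ'/φ)·y + A·ρ^{−1−2δ}` on `[R, R']` with `φ ≥ 1` nondecreasing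
`C¹`, then `y(ρ) ≤ φ(ρ)²·ρ^{−δ}·(y(R)·R^δ + A/(δ·R^δ))`. -/
theorem stmt19 (δ A R R' : ℝ) (hδ : 0 < δ) (hA : 0 ≤ A) (hR : 0 < R)
    (hRR' : R < R') (φ φ' y y' : ℝ → ℝ)
    (hφd : ∀ ρ ∈ Set.Icc R R', HasDerivWithinAt φ (φ' ρ) (Set.Icc R R') ρ)
    (hφ'c : ContinuousOn φ' (Set.Icc R R'))
    (hφ1 : ∀ ρ ∈ Set.Icc R R', 1 ≤ φ ρ)
    (hφmono : MonotoneOn φ (Set.Icc R R'))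
    (hyd : ∀ ρ ∈ Set.Icc R R', HasDerivWithinAt y (y' ρ) (Set.Icc R R') ρ)
    (hy'c : ContinuousOn y' (Set.Icc R R'))
    (hy0 : ∀ ρ ∈ Set.Icc R R', 0 ≤ y ρ)
    (hineq : ∀ ρ ∈ Set.Icc R R',
      y' ρ ≤ (-δ/ρ + 2 * φ' ρ / φ ρ) * y ρ + A * ρ ^ (-1 - 2*δ)) :
    ∀ ρ ∈ Set.Icc R R',
      y ρ ≤ φ ρ ^ 2 * ρ ^ (-δ) * (y R * R ^ δ + A / (δ * R ^ δ)) := by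
  have hpos : ∀ ρ ∈ Set.Icc R R', 0 < ρ := fun ρ h => hR.trans_le h.1
  have hφpos : ∀ ρ ∈ Set.Icc R R', 0 < φ ρ := fun ρ h => one_pos.trans_le (hφ1 ρ h)
  have hderiv : ∀ ρ ∈ Set.Icc R R', HasDerivWithinAt
      (fun t => y t * t ^ δ / φ t ^ 2 + A / δ * t ^ (-δ))
      (ρ ^ δ / φ ρ ^ 2 * (y' ρ - (-δ / ρ + 2 * φ' ρ / φ ρ) * y ρ) - A * ρ ^ (-δ - 1))
      (Set.Icc R R') ρ := by
    intro ρ hρ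
    have hρ0 := (hpos ρ hρ).ne'
    have hφ0 := (hφpos ρ hρ).ne'
    have hpow (p : ℝ) := (Real.hasDerivAt_rpow_const (p := p) (Or.inl hρ0)).hasDerivWithinAt
      (s := Set.Icc R R')
    refine ((((hyd ρ hρ).mul (hpow δ)).div ((hφd ρ hρ).pow 2) (pow_ne_zero 2 hφ0)).add
      ((hpow (-δ)).const_mul (A / δ))).congr_deriv ?_
    simp only [Pi.mul_apply, Pi.pow_apply]
    rw [Real.rpow_sub_one hρ0 δ]
    field_simp
    ring
  have hnonpos : ∀ ρ ∈ Set.Icc R R',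
      ρ ^ δ / φ ρ ^ 2 * (y' ρ - (-δ / ρ + 2 * φ' ρ / φ ρ) * y ρ) - A * ρ ^ (-δ - 1) ≤ 0 := by
    intro ρ hρ
    have hρ0 := hpos ρ hρ
    have hφ := hφ1 ρ hρ
    have hsplit : ρ ^ (-δ - 1) = ρ ^ δ * ρ ^ (-1 - 2 * δ) := by
      rw [← Real.rpow_add hρ0]
      ring_nf
    rw [sub_nonpos, hsplit]
    calc ρ ^ δ / φ ρ ^ 2 * (y' ρ - (-δ / ρ + 2 * φ' ρ / φ ρ) * y ρ)
        ≤ ρ ^ δ / φ ρ ^ 2 * (A * ρ ^ (-1 - 2 * δ)) := by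
          gcongr
          linarith [hineq ρ hρ]
      _ ≤ ρ ^ δ * (A * ρ ^ (-1 - 2 * δ)) := by
          gcongr
          exact div_le_self (by positivity) (one_le_pow₀ hφ)
      _ = A * (ρ ^ δ * ρ ^ (-1 - 2 * δ)) := by ring
  have hanti := antitoneOn_of_hasDerivWithinAt_nonpos (convex_Icc R R')
    (fun ρ hρ => (hderiv ρ hρ).continuousWithinAt)
    (fun ρ hρ => (hderiv ρ (interior_subset hρ)).mono interior_subset)
    (fun ρ hρ => hnonpos ρ (interior_subset hρ))
  intro ρ hρ
  have hRmem : R ∈ Set.Icc R R' := Set.left_mem_Icc.2 hRR'.le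
  have hρ0 := hpos ρ hρ
  have hφ := hφpos ρ hρ
  have hle : y ρ * ρ ^ δ / φ ρ ^ 2 ≤ y R * R ^ δ + A / (δ * R ^ δ) := by
    have hcompare := hanti hRmem hρ hρ.1
    have htail : 0 ≤ A / δ * ρ ^ (-δ) := by positivity
    have hinit : y R * R ^ δ / φ R ^ 2 ≤ y R * R ^ δ :=
      div_le_self (mul_nonneg (hy0 R hRmem) (by positivity)) (one_le_pow₀ (hφ1 R hRmem))
    have hconst : A / δ * R ^ (-δ) = A / (δ * R ^ δ) := by
      rw [Real.rpow_neg hR.le, ← div_eq_mul_inv, div_div]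
    simp only [hconst] at hcompare
    linarith
  calc y ρ = φ ρ ^ 2 * ρ ^ (-δ) * (y ρ * ρ ^ δ / φ ρ ^ 2) := by
        have := Real.rpow_pos_of_pos hρ0 δ
        rw [Real.rpow_neg hρ0.le]
        field_simp
    _ ≤ _ := by gcongr
end
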